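/- arXiv:2010.09128 — 7 statements merged into one kernel-verified Lean document; each statement's English description precedes it below -/
import Mathlib

section
/- In the Bayesian learning dynamics, the process log θ^t(s*) satisfies E[log θ^{t+1}(s*) | F_t] = log θ^t(s*) + D_KL(φ^{s*}(·|q^t) ‖ μ_t), where μ_t(·) = Σ_{s∈S} θ^t(s) φ^s(·|q^t) is the predicted payoff density; this KL divergence is nonnegative and at most −log θ^t(s*), so log θ^t(s*) is a submartingale bounded above by 0. Consequently θ^t(s*) converges almost surely to a strictly positive limit. -/
open MeasureTheory ProbabilityTheory Filter Topology

noncomputable section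

/-- Static environment of the Bayesian learning model: a convex compact strategy-profile
set `Q` and, for each parameter `s`, payoff densities `φ s q` on `ℝ^ι` (with respect to
Lebesgue measure), jointly measurable and continuous in `q`. -/
def IsBayesEnv {ι S E : Type} [Fintype ι] [Fintype S]
    [NormedAddCommGroup E] [NormedSpace ℝ E] [MeasurableSpace E]
    (strue : S) (Q : Set E) (φ : S → E → (ι → ℝ) → ℝ) : Prop :=
  IsCompact Q ∧ Convex ℝ Q ∧
    (∀ s : S, Measurable fun p : E × (ι → ℝ) => φ s p.1 p.2) ∧
    (∀ (s : S) (x : ι → ℝ), ContinuousOn (fun q => φ s q x) Q) ∧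
    (∀ s : S, ∀ q ∈ Q, (∀ x, 0 ≤ φ s q x) ∧ ∫ x : ι → ℝ, φ s q x = 1)

/-- A run `(θ, q, c)` of the Bayesian learning dynamics on a filtered probability space:
the initial belief `θ0` has full support; `q t` is `F t`-measurable with values in `Q`;
conditionally on `F t` the payoff `c t` has density `φ strue (·∣q t)`; and beliefs are
updated by Bayes' rule. -/
def IsBayesProcess {ι S E Ω : Type} [Fintype ι] [Fintype S]
    [NormedAddCommGroup E] [NormedSpace ℝ E] [MeasurableSpace E]
    [mΩ : MeasurableSpace Ω]
    (P : Measure Ω) (F : Filtration ℕ mΩ)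
    (strue : S) (Q : Set E) (φ : S → E → (ι → ℝ) → ℝ) (θ0 : S → ℝ)
    (θ : ℕ → Ω → S → ℝ) (q : ℕ → Ω → E) (c : ℕ → Ω → ι → ℝ) : Prop :=
  (∀ s, 0 < θ0 s) ∧ (∑ s, θ0 s = 1) ∧ (∀ ω, θ 0 ω = θ0) ∧
    (∀ t ω, q t ω ∈ Q) ∧
    (∀ t, Measurable[F t] (q t)) ∧
    (∀ t, Measurable[F (t + 1)] (c t)) ∧
    (∀ t, Measurable[F t] (θ t)) ∧
    (∀ (t : ℕ) (g : E × (ι → ℝ) → ℝ), Measurable g → (∀ p, |g p| ≤ 1) →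
      P[(fun ω => g (q t ω, c t ω))|F t]
        =ᵐ[P] fun ω => ∫ x : ι → ℝ, g (q t ω, x) * φ strue (q t ω) x) ∧
    (∀ t ω s, θ (t + 1) ω s =
      θ t ω s * φ s (q t ω) (c t ω) / ∑ s', θ t ω s' * φ s' (q t ω) (c t ω))


/-- The (real-valued) Kullback–Leibler divergence `∫ f log (f/g)` between two densities
on `ℝ^ι`. -/
def klReal {ι : Type} [Fintype ι] (f g : (ι → ℝ) → ℝ) : ℝ :=
  ∫ x : ι → ℝ, f x * Real.log (f x / g x)

open scoped ENNReal

section RelativeEntropy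

lemma sub_le_mul_log_div {f g a : ℝ} (hf : 0 ≤ f) (ha : 0 < a) (h : a * f ≤ g) :
    f - g ≤ f * Real.log (f / g) := by
  rcases hf.eq_or_lt with rfl | hf
  · simpa using h
  have hg : 0 < g := (mul_pos ha hf).trans_le h
  calc f - g = f * (1 - (f / g)⁻¹) := by field_simp
    _ ≤ f * Real.log (f / g) := by
      gcongr
      exact Real.one_sub_inv_le_log_of_pos (div_pos hf hg)

lemma mul_log_div_le {f g a : ℝ} (hf : 0 ≤ f) (ha : 0 < a) (h : a * f ≤ g) :
    f * Real.log (f / g) ≤ -Real.log a * f := by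
  rcases hf.eq_or_lt with rfl | hf
  · simp
  have hg : 0 < g := (mul_pos ha hf).trans_le h
  have hle : Real.log (f / g) ≤ Real.log a⁻¹ := by
    refine Real.log_le_log (div_pos hf hg) ?_
    rw [div_le_iff₀ hg, ← div_eq_inv_mul, le_div_iff₀ ha]
    linarith
  rw [Real.log_inv] at hle
  nlinarith

variable {γ : Type*} [MeasurableSpace γ] {ν : Measure γ} {f g : γ → ℝ} {a : ℝ}

lemma integrable_mul_log_div (hfm : Measurable f) (hgm : Measurable g)
    (hf : Integrable f ν) (hg : Integrable g ν) (hf0 : ∀ x, 0 ≤ f x) (ha : 0 < a)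
    (h : ∀ x, a * f x ≤ g x) : Integrable (fun x => f x * Real.log (f x / g x)) ν :=
  integrable_of_le_of_le (hfm.mul (hfm.div hgm).log).aestronglyMeasurable
    (ae_of_all _ fun x => sub_le_mul_log_div (hf0 x) ha (h x))
    (ae_of_all _ fun x => mul_log_div_le (hf0 x) ha (h x)) (hf.sub hg) (hf.const_mul _)

lemma integral_mul_log_div_nonneg (hfm : Measurable f) (hgm : Measurable g)
    (hf : Integrable f ν) (hg : Integrable g ν) (hf0 : ∀ x, 0 ≤ f x) (ha : 0 < a)
    (h : ∀ x, a * f x ≤ g x) (hfg : ∫ x, f x ∂ν = ∫ x, g x ∂ν) :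
    0 ≤ ∫ x, f x * Real.log (f x / g x) ∂ν := by
  have := integral_mono (hf.sub hg) (integrable_mul_log_div hfm hgm hf hg hf0 ha h)
    fun x => sub_le_mul_log_div (hf0 x) ha (h x)
  simpa [integral_sub hf hg, hfg] using this

lemma integral_mul_log_div_le (hfm : Measurable f) (hgm : Measurable g)
    (hf : Integrable f ν) (hg : Integrable g ν) (hf0 : ∀ x, 0 ≤ f x) (ha : 0 < a)
    (h : ∀ x, a * f x ≤ g x) (hf1 : ∫ x, f x ∂ν = 1) :
    ∫ x, f x * Real.log (f x / g x) ∂ν ≤ -Real.log a := by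
  have := integral_mono (integrable_mul_log_div hfm hgm hf hg hf0 ha h) (hf.const_mul _)
    fun x => mul_log_div_le (hf0 x) ha (h x)
  rwa [integral_const_mul, hf1, mul_one] at this

lemma lintegral_mul_enorm_log_div_le (hf : Integrable f ν) (hg : Integrable g ν)
    (hf0 : ∀ x, 0 ≤ f x) (ha : 0 < a) (ha1 : a ≤ 1) (h : ∀ x, a * f x ≤ g x)
    (hf1 : ∫ x, f x ∂ν = 1) (hg1 : ∫ x, g x ∂ν = 1) :
    ∫⁻ x, ENNReal.ofReal (f x) * ‖Real.log (f x / g x)‖ₑ ∂ν ≤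
      ENNReal.ofReal (1 - Real.log a) := by
  have hla : 0 ≤ -Real.log a := by linarith [Real.log_nonpos ha.le ha1]
  have hg0 : ∀ x, 0 ≤ g x := fun x => (mul_nonneg ha.le (hf0 x)).trans (h x)
  have hint : Integrable (fun x => g x + -Real.log a * f x) ν := hg.add (hf.const_mul _)
  calc ∫⁻ x, ENNReal.ofReal (f x) * ‖Real.log (f x / g x)‖ₑ ∂ν
      ≤ ∫⁻ x, ENNReal.ofReal (g x + -Real.log a * f x) ∂ν := by
        refine lintegral_mono fun x => ?_
        rw [← ofReal_norm, ← ENNReal.ofReal_mul (hf0 x)]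
        refine ENNReal.ofReal_le_ofReal ?_
        rw [Real.norm_eq_abs, ← abs_of_nonneg (hf0 x), ← abs_mul, abs_of_nonneg (hf0 x), abs_le]
        have h1 := sub_le_mul_log_div (hf0 x) ha (h x)
        have h2 := mul_log_div_le (hf0 x) ha (h x)
        have h3 := mul_nonneg hla (hf0 x)
        constructor <;> linarith [hf0 x, hg0 x]
    _ = ENNReal.ofReal (1 - Real.log a) := by
        rw [← ofReal_integral_eq_lintegral_ofReal hint
          (ae_of_all _ fun x => add_nonneg (hg0 x) (mul_nonneg hla (hf0 x))),
          integral_add hg (hf.const_mul _), integral_const_mul, hf1, hg1]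
        ring_nf

end RelativeEntropy

section ConditionalDensity

variable {Ω β γ : Type*} [MeasurableSpace Ω] [mβ : MeasurableSpace β]
  [MeasurableSpace γ] {P : Measure Ω} {X : Ω → β} {Y : Ω → γ}

lemma map_prodMk_eq_compProd_of_condExp [IsProbabilityMeasure P] [StandardBorelSpace γ] [Nonempty γ]
    {κ : Kernel β γ} [IsMarkovKernel κ] (hX : Measurable X) (hY : Measurable Y)
    (h : ∀ B, MeasurableSet B → P⟦Y ⁻¹' B|mβ.comap X⟧ =ᵐ[P] fun ω => (κ (X ω)).real B) :
    P.map (fun ω => (X ω, Y ω)) = P.map X ⊗ₘ κ := by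
  have : IsProbabilityMeasure (P.map X) := Measure.isProbabilityMeasure_map hX.aemeasurable
  rw [← compProd_map_condDistrib hY.aemeasurable]
  refine Measure.ext_prod fun {A B} hA hB => ?_
  rw [Measure.compProd_apply_prod hA hB, Measure.compProd_apply_prod hA hB,
    setLIntegral_map hA (Kernel.measurable_coe _ hB) hX,
    setLIntegral_map hA (Kernel.measurable_coe _ hB) hX]
  refine lintegral_congr_ae (ae_restrict_of_ae ?_)
  filter_upwards [condDistrib_ae_eq_condExp hX hY hB, h B hB] with ω h1 h2
  rw [h2] at h1
  exact (measureReal_eq_measureReal_iff).1 h1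

/-- The kernel with density `ψ b` with respect to a fixed measure `ν`. -/
def densityKernel (ν : Measure γ) [SFinite ν] (ψ : β → γ → ℝ) : Kernel β γ :=
  Kernel.withDensity (Kernel.const β ν) fun b x => ENNReal.ofReal (ψ b x)

variable {ν : Measure γ} [SFinite ν] {ψ : β → γ → ℝ}

lemma densityKernel_apply (hψ : Measurable (Function.uncurry ψ)) (b : β) :
    densityKernel ν ψ b = ν.withDensity fun x => ENNReal.ofReal (ψ b x) := by
  rw [densityKernel, Kernel.withDensity_apply _ hψ.ennreal_ofReal, Kernel.const_apply]

lemma integral_densityKernel (hψ : Measurable (Function.uncurry ψ)) (hψ0 : ∀ b x, 0 ≤ ψ b x)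
    (b : β) (g : γ → ℝ) : ∫ x, g x ∂(densityKernel ν ψ b) = ∫ x, ψ b x * g x ∂ν := by
  rw [densityKernel_apply hψ, integral_withDensity_eq_integral_toReal_smul
    (hψ.of_uncurry_left).ennreal_ofReal (ae_of_all _ fun _ => ENNReal.ofReal_lt_top)]
  simp [ENNReal.toReal_ofReal (hψ0 b _)]

lemma lintegral_densityKernel (hψ : Measurable (Function.uncurry ψ))
    (b : β) {g : γ → ℝ≥0∞} (hg : Measurable g) :
    ∫⁻ x, g x ∂(densityKernel ν ψ b) = ∫⁻ x, ENNReal.ofReal (ψ b x) * g x ∂ν :=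
  Kernel.lintegral_withDensity _ hψ.ennreal_ofReal b hg

lemma isMarkovKernel_densityKernel (hψ : Measurable (Function.uncurry ψ))
    (hψ0 : ∀ b x, 0 ≤ ψ b x) (hψ1 : ∀ b, ∫ x, ψ b x ∂ν = 1) :
    IsMarkovKernel (densityKernel ν ψ) := by
  refine ⟨fun b => ⟨?_⟩⟩
  have hint : Integrable (ψ b) ν := .of_integral_ne_zero (by simp [hψ1 b])
  rw [densityKernel_apply hψ, withDensity_apply _ .univ, Measure.restrict_univ,
    ← ofReal_integral_eq_lintegral_ofReal hint (ae_of_all _ (hψ0 b)), hψ1, ENNReal.ofReal_one]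

/-- `Y` has conditional density `ψ (X ·)` with respect to `ν`, given `X`. -/
structure HasCondDensity (P : Measure Ω) (ν : Measure γ) (X : Ω → β) (Y : Ω → γ)
    (ψ : β → γ → ℝ) : Prop where
  measurable_left : Measurable X
  measurable_right : Measurable Y
  measurable_density : Measurable (Function.uncurry ψ)
  nonneg : ∀ b x, 0 ≤ ψ b x
  integral_eq_one : ∀ b, ∫ x, ψ b x ∂ν = 1
  condExp_eq : ∀ B, MeasurableSet B →
    P⟦Y ⁻¹' B|mβ.comap X⟧ =ᵐ[P] fun ω => ∫ x in B, ψ (X ω) x ∂ν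

namespace HasCondDensity

lemma isMarkovKernel (H : HasCondDensity P ν X Y ψ) : IsMarkovKernel (densityKernel ν ψ) :=
  isMarkovKernel_densityKernel H.measurable_density H.nonneg H.integral_eq_one

variable [IsProbabilityMeasure P] [StandardBorelSpace γ] [Nonempty γ]

lemma map_prodMk (H : HasCondDensity P ν X Y ψ) :
    P.map (fun ω => (X ω, Y ω)) = P.map X ⊗ₘ densityKernel ν ψ := by
  have := H.isMarkovKernel
  refine map_prodMk_eq_compProd_of_condExp H.measurable_left H.measurable_right fun B hB => ?_
  filter_upwards [H.condExp_eq B hB] with ω hω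
  rw [hω, ← integral_indicator_one hB, integral_densityKernel H.measurable_density H.nonneg,
    ← integral_indicator hB]
  congr 1 with x
  by_cases hx : x ∈ B <;> simp [hx]

lemma lintegral_comp (H : HasCondDensity P ν X Y ψ) {h : β × γ → ℝ≥0∞} (hh : Measurable h) :
    ∫⁻ ω, h (X ω, Y ω) ∂P = ∫⁻ ω, ∫⁻ x, ENNReal.ofReal (ψ (X ω) x) * h (X ω, x) ∂ν ∂P := by
  have := H.isMarkovKernel
  have : IsProbabilityMeasure (P.map X) :=
    Measure.isProbabilityMeasure_map H.measurable_left.aemeasurable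
  rw [← lintegral_map hh (H.measurable_left.prodMk H.measurable_right), H.map_prodMk,
    Measure.lintegral_compProd hh, lintegral_map hh.lintegral_kernel_prod_right' H.measurable_left]
  refine lintegral_congr fun ω => ?_
  exact lintegral_densityKernel H.measurable_density _ (hh.comp measurable_prodMk_left)

lemma ae_pos (H : HasCondDensity P ν X Y ψ) : ∀ᵐ ω ∂P, 0 < ψ (X ω) (Y ω) := by
  have hs : MeasurableSet {p : β × γ | ψ p.1 p.2 = 0} :=
    H.measurable_density (measurableSet_singleton 0)
  have hm := H.lintegral_comp (measurable_one.indicator hs)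
  have hz : ∀ ω x, ENNReal.ofReal (ψ (X ω) x) *
      ({p : β × γ | ψ p.1 p.2 = 0}.indicator (1 : β × γ → ℝ≥0∞)) (X ω, x) = 0 := by
    intro ω x
    by_cases hx : ψ (X ω) x = 0 <;> simp [hx]
  simp_rw [hz, lintegral_zero] at hm
  have hae := (lintegral_eq_zero_iff ((measurable_one.indicator hs).comp
    (H.measurable_left.prodMk H.measurable_right))).1 hm
  filter_upwards [hae] with ω hω
  refine (H.nonneg _ _).lt_of_ne' fun h0 => ?_
  simp [h0] at hω

lemma integrable_comp (H : HasCondDensity P ν X Y ψ) {h : β × γ → ℝ} (hh : Measurable h)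
    (hfin : ∫⁻ ω, ∫⁻ x, ENNReal.ofReal (ψ (X ω) x) * ‖h (X ω, x)‖ₑ ∂ν ∂P ≠ ∞) :
    Integrable (fun ω => h (X ω, Y ω)) P := by
  refine ⟨(hh.comp (H.measurable_left.prodMk H.measurable_right)).aestronglyMeasurable, ?_⟩
  rw [HasFiniteIntegral, H.lintegral_comp hh.enorm]
  exact hfin.lt_top

lemma condExp_comp (H : HasCondDensity P ν X Y ψ) {h : β × γ → ℝ} (hh : Measurable h)
    (hint : Integrable (fun ω => h (X ω, Y ω)) P) :
    P[fun ω => h (X ω, Y ω)|mβ.comap X] =ᵐ[P] fun ω => ∫ x, ψ (X ω) x * h (X ω, x) ∂ν := by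
  have := H.isMarkovKernel
  have hXY := H.measurable_left.prodMk H.measurable_right
  have hcd := ae_of_ae_map H.measurable_left.aemeasurable
    (condDistrib_ae_eq_of_measure_eq_compProd X H.measurable_right.aemeasurable H.map_prodMk)
  have hc := condExp_prod_ae_eq_integral_condDistrib' H.measurable_left
    H.measurable_right.aemeasurable
    ((integrable_map_measure hh.aestronglyMeasurable hXY.aemeasurable).2 hint)
  filter_upwards [hcd, hc] with ω h1 h2
  rw [h2, h1, integral_densityKernel H.measurable_density H.nonneg]

/-- Bounds on the prior weight `a` of the density `ψ` in the predicted density `g` make the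
log-likelihood ratio integrable. -/
lemma integrable_log_div (H : HasCondDensity P ν X Y ψ) {g : β → γ → ℝ}
    (hg : Measurable (Function.uncurry g)) {a : Ω → ℝ}
    (ha : Integrable (fun ω => Real.log (a ω)) P)
    (hb : ∀ᵐ ω ∂P, 0 < a ω ∧ a ω ≤ 1 ∧ (∀ x, a ω * ψ (X ω) x ≤ g (X ω) x) ∧
      ∫ x, g (X ω) x ∂ν = 1) :
    Integrable (fun ω => Real.log (ψ (X ω) (Y ω) / g (X ω) (Y ω))) P := by
  have hint : Integrable (fun ω => 1 - Real.log (a ω)) P := (integrable_const 1).sub ha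
  refine H.integrable_comp (h := fun p => Real.log (ψ p.1 p.2 / g p.1 p.2))
    (H.measurable_density.div hg).log (ne_top_of_le_ne_top hint.lintegral_lt_top.ne ?_)
  refine lintegral_mono_ae ?_
  filter_upwards [hb] with ω ⟨h0, h1, hle, hg1⟩
  exact lintegral_mul_enorm_log_div_le
    (.of_integral_ne_zero (by simp [H.integral_eq_one (X ω)]))
    (.of_integral_ne_zero (by simp [hg1])) (H.nonneg _) h0 h1 hle (H.integral_eq_one _) hg1

lemma condExp_log_div (H : HasCondDensity P ν X Y ψ) {g : β → γ → ℝ}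
    (hg : Measurable (Function.uncurry g))
    (hint : Integrable (fun ω => Real.log (ψ (X ω) (Y ω) / g (X ω) (Y ω))) P) :
    P[fun ω => Real.log (ψ (X ω) (Y ω) / g (X ω) (Y ω))|mβ.comap X] =ᵐ[P]
      fun ω => ∫ x, ψ (X ω) x * Real.log (ψ (X ω) x / g (X ω) x) ∂ν :=
  H.condExp_comp (h := fun p => Real.log (ψ p.1 p.2 / g p.1 p.2))
    (H.measurable_density.div hg).log hint

end HasCondDensity

end ConditionalDensity

section BayesianLearning

variable {ι S E : Type} [Fintype ι] [Fintype S]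
  [NormedAddCommGroup E] [NormedSpace ℝ E] [MeasurableSpace E]
  {strue : S} {Q : Set E} {φ : S → E → (ι → ℝ) → ℝ}

/-- The payoff density predicted by the belief `r` at the strategy profile `e`. -/
def predictedDensity (φ : S → E → (ι → ℝ) → ℝ) (r : S → ℝ) (e : E) (x : ι → ℝ) : ℝ :=
  ∑ s, r s * φ s e x

namespace IsBayesEnv

lemma measurable_density (henv : IsBayesEnv strue Q φ) (s : S) {β : Type*} [MeasurableSpace β]
    {e : β → E} (he : Measurable e) :
    Measurable (Function.uncurry fun b x => φ s (e b) x) :=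
  (henv.2.2.1 s).comp ((he.comp measurable_fst).prodMk measurable_snd)

lemma measurable_predictedDensity (henv : IsBayesEnv strue Q φ) {β : Type*} [MeasurableSpace β]
    {r : β → S → ℝ} (hr : Measurable r) {e : β → E} (he : Measurable e) :
    Measurable (Function.uncurry fun b x => predictedDensity φ (r b) (e b) x) := by
  refine Finset.measurable_sum _ fun s _ => ?_
  exact ((measurable_pi_apply s).comp (hr.comp measurable_fst)).mul (henv.measurable_density s he)

variable {e : E} {r : S → ℝ}

lemma density_nonneg (henv : IsBayesEnv strue Q φ) (he : e ∈ Q) (s : S) (x : ι → ℝ) :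
    0 ≤ φ s e x :=
  (henv.2.2.2.2 s e he).1 x

lemma integral_density (henv : IsBayesEnv strue Q φ) (he : e ∈ Q) (s : S) :
    ∫ x, φ s e x = 1 :=
  (henv.2.2.2.2 s e he).2

lemma integrable_density (henv : IsBayesEnv strue Q φ) (he : e ∈ Q) (s : S) :
    Integrable (φ s e) :=
  .of_integral_ne_zero (by simp [henv.integral_density he s])

lemma integral_predictedDensity (henv : IsBayesEnv strue Q φ) (he : e ∈ Q)
    (hr : r ∈ stdSimplex ℝ S) : ∫ x, predictedDensity φ r e x = 1 := by
  simp only [predictedDensity]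
  rw [integral_finsetSum _ fun s _ => (henv.integrable_density he s).const_mul _]
  simp [integral_const_mul, henv.integral_density he, hr.2]

lemma mul_density_le_predictedDensity (henv : IsBayesEnv strue Q φ) (he : e ∈ Q)
    (hr : r ∈ stdSimplex ℝ S) (s : S) (x : ι → ℝ) : r s * φ s e x ≤ predictedDensity φ r e x :=
  Finset.single_le_sum (f := fun s => r s * φ s e x)
    (fun s _ => mul_nonneg (hr.1 s) (henv.density_nonneg he s x)) (Finset.mem_univ s)

lemma klReal_predictedDensity_mem_Icc (henv : IsBayesEnv strue Q φ) (he : e ∈ Q)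
    (hr : r ∈ stdSimplex ℝ S) {s : S} (hs : 0 < r s) :
    klReal (φ s e) (predictedDensity φ r e) ∈ Set.Icc 0 (-Real.log (r s)) := by
  have hfm : Measurable (φ s e) :=
    (henv.measurable_density s (measurable_id (α := E))).of_uncurry_left
  have hgm : Measurable (predictedDensity φ r e) :=
    (henv.measurable_predictedDensity measurable_snd
      measurable_fst).of_uncurry_left (x := (e, r))
  have hg1 := henv.integral_predictedDensity he hr
  have hg : Integrable (predictedDensity φ r e) := .of_integral_ne_zero (by simp [hg1])
  have hf := henv.integrable_density he s
  have hle := henv.mul_density_le_predictedDensity he hr s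
  have hf1 := henv.integral_density he s
  exact ⟨integral_mul_log_div_nonneg hfm hgm hf hg (henv.density_nonneg he s) hs hle
      (hf1.trans hg1.symm),
    integral_mul_log_div_le hfm hgm hf hg (henv.density_nonneg he s) hs hle hf1⟩

end IsBayesEnv

/-- Bayes' rule maps a belief to a belief as soon as the predicted density does not vanish. -/
lemma posterior_mem_stdSimplex {r ℓ : S → ℝ} (hr : ∀ s, 0 ≤ r s) (hℓ : ∀ s, 0 ≤ ℓ s)
    (h : ∑ s, r s * ℓ s ≠ 0) :
    (fun s => r s * ℓ s / ∑ s', r s' * ℓ s') ∈ stdSimplex ℝ S :=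
  ⟨fun s => div_nonneg (mul_nonneg (hr s) (hℓ s))
      (Finset.sum_nonneg fun s _ => mul_nonneg (hr s) (hℓ s)),
    by rw [← Finset.sum_div, div_self h]⟩

namespace IsBayesProcess

variable {Ω : Type} [mΩ : MeasurableSpace Ω] {P : Measure Ω}
  {F : Filtration ℕ mΩ} {θ0 : S → ℝ} {θ : ℕ → Ω → S → ℝ} {q : ℕ → Ω → E} {c : ℕ → Ω → ι → ℝ}

lemma hasCondDensity (henv : IsBayesEnv strue Q φ)
    (hproc : IsBayesProcess P F strue Q φ θ0 θ q c) (t : ℕ) :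
    @HasCondDensity Ω Ω (ι → ℝ) mΩ (F t) _ P volume id (c t) fun ω => φ strue (q t ω) := by
  obtain ⟨-, -, -, hQ, hq, hc, -, hcond, -⟩ := hproc
  refine @HasCondDensity.mk Ω Ω (ι → ℝ) mΩ (F t) _ P volume id (c t) _
    (measurable_id'' (F.le t)) ((hc t).mono (F.le (t + 1)) le_rfl)
    (@IsBayesEnv.measurable_density _ _ _ _ _ _ _ _ _ _ _ henv strue Ω (F t) _ (hq t))
    (fun ω => henv.density_nonneg (hQ t ω) strue)
    (fun ω => henv.integral_density (hQ t ω) strue) fun B hB => ?_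
  rw [MeasurableSpace.comap_id]
  have h := hcond t (fun p => B.indicator 1 p.2)
    ((measurable_one.indicator hB).comp measurable_snd) fun p => by
      by_cases hp : p.2 ∈ B <;> simp [hp]
  refine h.trans (ae_of_all _ fun ω => ?_)
  simp only [id]
  rw [← integral_indicator hB]
  congr 1 with x
  by_cases hx : x ∈ B <;> simp [hx]

lemma measurable_log (hproc : IsBayesProcess P F strue Q φ θ0 θ q c) (t : ℕ) (s : S) :
    Measurable[F t] fun ω => Real.log (θ t ω s) :=
  Real.measurable_log.comp ((measurable_pi_apply s).comp (hproc.2.2.2.2.2.2.1 t))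

lemma measurable_uncurry_predictedDensity (henv : IsBayesEnv strue Q φ)
    (hproc : IsBayesProcess P F strue Q φ θ0 θ q c) (t : ℕ) :
    Measurable[(F t).prod MeasurableSpace.pi]
      (Function.uncurry fun ω x => predictedDensity φ (θ t ω) (q t ω) x) :=
  @IsBayesEnv.measurable_predictedDensity _ _ _ _ _ _ _ _ _ _ _ henv Ω (F t)
    _ (hproc.2.2.2.2.2.2.1 t) _ (hproc.2.2.2.2.1 t)

variable [IsProbabilityMeasure P]

lemma ae_density_pos (henv : IsBayesEnv strue Q φ)
    (hproc : IsBayesProcess P F strue Q φ θ0 θ q c) (t : ℕ) :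
    ∀ᵐ ω ∂P, 0 < φ strue (q t ω) (c t ω) :=
  @HasCondDensity.ae_pos _ _ _ mΩ (F t) _ _ _ _ _ _ _ _ _ _ (hproc.hasCondDensity henv t)

/-- Beliefs almost surely stay in the simplex and keep the true parameter in their support. -/
lemma ae_mem_stdSimplex (henv : IsBayesEnv strue Q φ)
    (hproc : IsBayesProcess P F strue Q φ θ0 θ q c) (t : ℕ) :
    ∀ᵐ ω ∂P, θ t ω ∈ stdSimplex ℝ S ∧ 0 < θ t ω strue := by
  have hpos := hproc.ae_density_pos henv
  obtain ⟨h0, h1, hθ0, hQ, -, -, -, -, hstep⟩ := hproc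
  induction t with
  | zero =>
    refine ae_of_all _ fun ω => ?_
    rw [hθ0]
    exact ⟨⟨fun s => (h0 s).le, h1⟩, h0 strue⟩
  | succ t ih =>
    filter_upwards [ih, hpos t] with ω ⟨hr, hrs⟩ hφ
    have hZ : 0 < ∑ s, θ t ω s * φ s (q t ω) (c t ω) :=
      (mul_pos hrs hφ).trans_le (henv.mul_density_le_predictedDensity (hQ t ω) hr strue (c t ω))
    rw [show θ (t + 1) ω = _ from funext (hstep t ω)]
    exact ⟨posterior_mem_stdSimplex hr.1 (fun s => henv.density_nonneg (hQ t ω) s _) hZ.ne',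
      div_pos (mul_pos hrs hφ) hZ⟩

lemma ae_log_succ (henv : IsBayesEnv strue Q φ)
    (hproc : IsBayesProcess P F strue Q φ θ0 θ q c) (t : ℕ) :
    (fun ω => Real.log (θ (t + 1) ω strue)) =ᵐ[P] fun ω => Real.log (θ t ω strue) +
      Real.log (φ strue (q t ω) (c t ω) / predictedDensity φ (θ t ω) (q t ω) (c t ω)) := by
  filter_upwards [hproc.ae_mem_stdSimplex henv t, hproc.ae_density_pos henv t] with ω ⟨hr, hrs⟩ hφ
  obtain ⟨-, -, -, hQ, -, -, -, -, hstep⟩ := hproc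
  have hZ : 0 < predictedDensity φ (θ t ω) (q t ω) (c t ω) :=
    (mul_pos hrs hφ).trans_le (henv.mul_density_le_predictedDensity (hQ t ω) hr strue (c t ω))
  rw [hstep, mul_div_assoc]
  exact Real.log_mul hrs.ne' (div_pos hφ hZ).ne'

lemma integrable_log_ratio (henv : IsBayesEnv strue Q φ)
    (hproc : IsBayesProcess P F strue Q φ θ0 θ q c) (t : ℕ)
    (hint : Integrable (fun ω => Real.log (θ t ω strue)) P) :
    Integrable (fun ω => Real.log (φ strue (q t ω) (c t ω) /
      predictedDensity φ (θ t ω) (q t ω) (c t ω))) P := by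
  refine @HasCondDensity.integrable_log_div _ _ _ mΩ (F t) _ _ _ _ _ _ _ _ _ _
    (hproc.hasCondDensity henv t) _ (hproc.measurable_uncurry_predictedDensity henv t)
    (fun ω => θ t ω strue) hint ?_
  filter_upwards [hproc.ae_mem_stdSimplex henv t] with ω ⟨hr, hrs⟩
  have hq := hproc.2.2.2.1 t ω
  exact ⟨hrs, (mem_Icc_of_mem_stdSimplex hr strue).2,
    henv.mul_density_le_predictedDensity hq hr strue, henv.integral_predictedDensity hq hr⟩

lemma integrable_log (henv : IsBayesEnv strue Q φ)
    (hproc : IsBayesProcess P F strue Q φ θ0 θ q c) (t : ℕ) :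
    Integrable (fun ω => Real.log (θ t ω strue)) P := by
  induction t with
  | zero => simpa only [hproc.2.2.1] using integrable_const (Real.log (θ0 strue))
  | succ t ih =>
    exact (ih.add (hproc.integrable_log_ratio henv t ih)).congr (hproc.ae_log_succ henv t).symm

lemma condExp_log_succ (henv : IsBayesEnv strue Q φ)
    (hproc : IsBayesProcess P F strue Q φ θ0 θ q c) (t : ℕ) :
    P[(fun ω => Real.log (θ (t + 1) ω strue))|F t] =ᵐ[P] fun ω => Real.log (θ t ω strue) +
      klReal (φ strue (q t ω)) (predictedDensity φ (θ t ω) (q t ω)) := by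
  have hint := hproc.integrable_log henv t
  have hratio := hproc.integrable_log_ratio henv t hint
  have hkl := @HasCondDensity.condExp_log_div _ _ _ mΩ (F t) _ _ _ _ _ _ _ _ _ _
    (hproc.hasCondDensity henv t) _ (hproc.measurable_uncurry_predictedDensity henv t) hratio
  rw [MeasurableSpace.comap_id] at hkl
  filter_upwards [condExp_congr_ae (m := F t) (hproc.ae_log_succ henv t),
    condExp_add hint hratio (F t), hkl] with ω h1 h2 h3
  rw [h1]
  refine h2.trans ?_
  rw [Pi.add_apply, condExp_of_stronglyMeasurable (F.le t)
    (hproc.measurable_log t strue).stronglyMeasurable hint]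
  exact congrArg _ h3

lemma ae_klReal_mem_Icc (henv : IsBayesEnv strue Q φ)
    (hproc : IsBayesProcess P F strue Q φ θ0 θ q c) (t : ℕ) :
    ∀ᵐ ω ∂P, klReal (φ strue (q t ω)) (predictedDensity φ (θ t ω) (q t ω)) ∈
      Set.Icc 0 (-Real.log (θ t ω strue)) := by
  filter_upwards [hproc.ae_mem_stdSimplex henv t] with ω ⟨hr, hrs⟩
  exact henv.klReal_predictedDensity_mem_Icc (hproc.2.2.2.1 t ω) hr hrs

lemma ae_log_nonpos (henv : IsBayesEnv strue Q φ)
    (hproc : IsBayesProcess P F strue Q φ θ0 θ q c) (t : ℕ) :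
    ∀ᵐ ω ∂P, Real.log (θ t ω strue) ≤ 0 := by
  filter_upwards [hproc.ae_mem_stdSimplex henv t] with ω ⟨hr, hrs⟩
  exact Real.log_nonpos hrs.le (mem_Icc_of_mem_stdSimplex hr strue).2

lemma submartingale_log (henv : IsBayesEnv strue Q φ)
    (hproc : IsBayesProcess P F strue Q φ θ0 θ q c) :
    Submartingale (fun t ω => Real.log (θ t ω strue)) F P := by
  refine submartingale_nat (fun t => (hproc.measurable_log t strue).stronglyMeasurable)
    (hproc.integrable_log henv) fun t => ?_
  filter_upwards [hproc.condExp_log_succ henv t, hproc.ae_klReal_mem_Icc henv t] with ω h1 h2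
  rw [h1]
  linarith [h2.1]

end IsBayesProcess

end BayesianLearning

/-- A submartingale that is almost surely nonpositive converges almost surely. -/
lemma MeasureTheory.Submartingale.exists_ae_tendsto_of_nonpos {Ω : Type*}
    {mΩ : MeasurableSpace Ω} {P : Measure Ω} [IsFiniteMeasure P] {F : Filtration ℕ mΩ}
    {f : ℕ → Ω → ℝ} (hf : Submartingale f F P) (hf0 : ∀ t, ∀ᵐ ω ∂P, f t ω ≤ 0) :
    ∀ᵐ ω ∂P, ∃ l, Tendsto (fun t => f t ω) atTop (𝓝 l) := by
  refine hf.exists_ae_tendsto_of_bdd (R := (-∫ ω, f 0 ω ∂P).toNNReal) fun t => ?_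
  have hmono := hf.setIntegral_le (Nat.zero_le t) MeasurableSet.univ
  simp only [setIntegral_univ] at hmono
  calc eLpNorm (f t) 1 P = ∫⁻ ω, ENNReal.ofReal (-f t ω) ∂P := by
        rw [eLpNorm_one_eq_lintegral_enorm]
        refine lintegral_congr_ae ?_
        filter_upwards [hf0 t] with ω hω
        rw [← ofReal_norm, Real.norm_of_nonpos hω]
    _ = ENNReal.ofReal (-∫ ω, f t ω ∂P) := by
        rw [← integral_neg, ofReal_integral_eq_lintegral_ofReal
          (f := fun ω => -f t ω) (hf.integrable t).neg]
        filter_upwards [hf0 t] with ω hω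
        simpa using hω
    _ ≤ ENNReal.ofReal (-∫ ω, f 0 ω ∂P) := ENNReal.ofReal_le_ofReal (neg_le_neg hmono)

/-- **The log-belief of the true parameter is a bounded submartingale.**
`E[log θ^{t+1}(s*) ∣ F_t] = log θ^t(s*) + D_KL(φ^{s*}(·∣q^t) ‖ μ_t)` where
`μ_t = Σ_s θ^t(s) φ^s(·∣q^t)` is the predicted payoff density; this KL divergence is
nonnegative and at most `−log θ^t(s*)`; hence `log θ^t(s*)` is a submartingale bounded
above by `0`, and `θ^t(s*)` converges a.s. to a strictly positive limit. -/
theorem log_true_belief_submartingale {ι S E Ω : Type} [Fintype ι] [Fintype S]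
    [NormedAddCommGroup E] [NormedSpace ℝ E] [MeasurableSpace E] [BorelSpace E]
    [mΩ : MeasurableSpace Ω]
    (P : Measure Ω) [IsProbabilityMeasure P] (F : Filtration ℕ mΩ)
    (strue : S) (Q : Set E) (φ : S → E → (ι → ℝ) → ℝ)
    (θ0 : S → ℝ) (θ : ℕ → Ω → S → ℝ) (q : ℕ → Ω → E) (c : ℕ → Ω → ι → ℝ)
    (henv : IsBayesEnv strue Q φ)
    (hproc : IsBayesProcess P F strue Q φ θ0 θ q c) :
    (∀ t : ℕ, P[(fun ω => Real.log (θ (t + 1) ω strue))|F t]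
        =ᵐ[P] fun ω => Real.log (θ t ω strue) +
          klReal (φ strue (q t ω)) (fun x => ∑ s, θ t ω s * φ s (q t ω) x)) ∧
    (∀ᵐ ω ∂P, ∀ t : ℕ,
      0 ≤ klReal (φ strue (q t ω)) (fun x => ∑ s, θ t ω s * φ s (q t ω) x) ∧
      klReal (φ strue (q t ω)) (fun x => ∑ s, θ t ω s * φ s (q t ω) x) ≤
        -Real.log (θ t ω strue)) ∧
    Submartingale (fun t ω => Real.log (θ t ω strue)) F P ∧
    (∀ᵐ ω ∂P, ∀ t : ℕ, Real.log (θ t ω strue) ≤ 0) ∧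
    ∃ L : Ω → ℝ, ∀ᵐ ω ∂P, 0 < L ω ∧
      Tendsto (fun t => θ t ω strue) atTop (𝓝 (L ω)) := by
  have hsub := hproc.submartingale_log henv
  refine ⟨hproc.condExp_log_succ henv, ae_all_iff.2 (hproc.ae_klReal_mem_Icc henv), hsub,
    ae_all_iff.2 (hproc.ae_log_nonpos henv), ?_⟩
  have hconv : ∀ᵐ ω ∂P, ∃ L, 0 < L ∧ Tendsto (fun t => θ t ω strue) atTop (𝓝 L) := by
    filter_upwards [hsub.exists_ae_tendsto_of_nonpos (hproc.ae_log_nonpos henv),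
      ae_all_iff.2 (hproc.ae_mem_stdSimplex henv)] with ω ⟨l, hl⟩ hω
    refine ⟨Real.exp l, Real.exp_pos l, ?_⟩
    simpa only [Function.comp_def, Real.exp_log (hω _).2] using
      (Real.continuous_exp.tendsto l).comp hl
  obtain ⟨L, hL⟩ := hconv.choice
  exact ⟨L, hL⟩
end
end

section
/- In the Bayesian learning dynamics, the belief sequence (θ^t) converges almost surely: there is a random θ̄ ∈ Δ(S) such that θ^t(s) → θ̄(s) almost surely for every s ∈ S, and θ̄(s*) > 0 almost surely. -/
open MeasureTheory ProbabilityTheory Filter Topology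

noncomputable section

/-- A nonnegative adapted real process whose integrals over past events do not increase
converges almost surely. -/
theorem ae_tendsto_of_setLIntegral_succ_le {Ω : Type*} {mΩ : MeasurableSpace Ω}
    {P : Measure Ω} [IsFiniteMeasure P] {F : Filtration ℕ mΩ} {Z : ℕ → Ω → ℝ}
    (hZ0 : ∀ t ω, 0 ≤ Z t ω) (hZm : ∀ t, Measurable[F t] (Z t))
    (hfin : ∫⁻ ω, ENNReal.ofReal (Z 0 ω) ∂P ≠ ⊤)
    (hstep : ∀ t B, MeasurableSet[F t] B →
      ∫⁻ ω in B, ENNReal.ofReal (Z (t + 1) ω) ∂P ≤ ∫⁻ ω in B, ENNReal.ofReal (Z t ω) ∂P) :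
    ∀ᵐ ω ∂P, ∃ l, Tendsto (fun t => Z t ω) atTop (𝓝 l) := by
  have hle (t : ℕ) : ∫⁻ ω, ENNReal.ofReal (Z t ω) ∂P ≤ ∫⁻ ω, ENNReal.ofReal (Z 0 ω) ∂P := by
    induction t with
    | zero => exact le_rfl
    | succ t ih => exact (by simpa using hstep t Set.univ MeasurableSet.univ : _ ≤ _).trans ih
  have hmeas (t : ℕ) : Measurable (Z t) := (hZm t).mono (F.le t) le_rfl
  have hint (t : ℕ) : Integrable (Z t) P := by
    refine ⟨(hmeas t).aestronglyMeasurable, ?_⟩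
    rw [hasFiniteIntegral_iff_ofReal (ae_of_all _ (hZ0 t))]
    exact (hle t).trans_lt hfin.lt_top
  have hsuper : Supermartingale Z F P := by
    refine supermartingale_of_setIntegral_succ_le (fun t => (hZm t).stronglyMeasurable) hint
      fun t B hB => ?_
    have hnn (u : ℕ) : 0 ≤ᵐ[P.restrict B] Z u := ae_of_all _ (hZ0 u)
    rw [integral_eq_lintegral_of_nonneg_ae (hnn _) (hmeas _).aestronglyMeasurable,
      integral_eq_lintegral_of_nonneg_ae (hnn _) (hmeas _).aestronglyMeasurable]
    refine ENNReal.toReal_mono ?_ (hstep t B hB)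
    exact ((setLIntegral_le_lintegral B _).trans_lt ((hle t).trans_lt hfin.lt_top)).ne
  have hbdd (t : ℕ) : eLpNorm ((-Z) t) 1 P ≤
      ((∫⁻ ω, ENNReal.ofReal (Z 0 ω) ∂P).toNNReal : ENNReal) := by
    rw [ENNReal.coe_toNNReal hfin, Pi.neg_apply, eLpNorm_neg, eLpNorm_one_eq_lintegral_enorm]
    simpa only [Real.enorm_of_nonneg (hZ0 t _)] using hle t
  filter_upwards [hsuper.neg.exists_ae_tendsto_of_bdd hbdd] with ω ⟨l, hl⟩
  exact ⟨-l, by simpa using hl.neg⟩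

/-- A density whose integrals over all `m`-measurable sets are at most their measure does not
increase integrals of `m`-measurable functions. -/
theorem lintegral_mul_le_of_setLIntegral_le {Ω : Type*} {m mΩ : MeasurableSpace Ω}
    {P : Measure Ω} (hm : m ≤ mΩ) {r f : Ω → ENNReal} (hr : Measurable r)
    (hle : ∀ B, MeasurableSet[m] B → ∫⁻ ω in B, r ω ∂P ≤ P B) (hf : Measurable[m] f) :
    ∫⁻ ω, f ω * r ω ∂P ≤ ∫⁻ ω, f ω ∂P := by
  have hmeasure : (P.withDensity r).trim hm ≤ P.trim hm := by
    refine Measure.le_iff.2 fun B hB => ?_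
    rw [trim_measurableSet_eq hm hB, trim_measurableSet_eq hm hB,
      withDensity_apply _ (hm B hB)]
    exact hle B hB
  calc ∫⁻ ω, f ω * r ω ∂P = ∫⁻ ω, f ω ∂(P.withDensity r) := by
        rw [lintegral_withDensity_eq_lintegral_mul _ hr (hf.mono hm le_rfl)]
        simp only [Pi.mul_apply, mul_comm]
    _ = ∫⁻ ω, f ω ∂((P.withDensity r).trim hm) := (lintegral_trim hm hf).symm
    _ ≤ ∫⁻ ω, f ω ∂(P.trim hm) := lintegral_mono' hmeasure le_rfl
    _ = ∫⁻ ω, f ω ∂P := lintegral_trim hm hf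

/-- A nonnegative function whose rescaled truncations have conditional expectation at most
`1 / (n + 1)` integrates over every `m`-measurable set to at most the measure of that set. -/
theorem setLIntegral_ofReal_le_of_condExp_min_le {Ω : Type*} {m mΩ : MeasurableSpace Ω}
    {P : Measure Ω} [IsFiniteMeasure P] (hm : m ≤ mΩ) {X : Ω → ℝ} (hX : Measurable X)
    (hX0 : ∀ ω, 0 ≤ X ω)
    (hle : ∀ n : ℕ, P[(fun ω => min (X ω / (n + 1)) 1)|m] ≤ᵐ[P] fun _ => 1 / ((n : ℝ) + 1))
    {B : Set Ω} (hB : MeasurableSet[m] B) :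
    ∫⁻ ω in B, ENNReal.ofReal (X ω) ∂P ≤ P B := by
  have hscale (n : ℕ) (x : ℝ) : min x (n + 1) = (n + 1) * min (x / (n + 1)) 1 := by
    rw [mul_min_of_nonneg _ _ (by positivity), mul_div_cancel₀ _ (by positivity), mul_one]
  have htrunc (n : ℕ) : ∫⁻ ω in B, ENNReal.ofReal (min (X ω) (n + 1)) ∂P ≤ P B := by
    have hg0 (ω : Ω) : 0 ≤ min (X ω / (n + 1)) 1 :=
      le_min (div_nonneg (hX0 ω) (by positivity)) zero_le_one
    have hgm : Measurable fun ω => min (X ω / (n + 1)) 1 := (hX.div_const _).min measurable_const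
    have hgi : Integrable (fun ω => min (X ω / (n + 1)) 1) P :=
      Integrable.of_bound hgm.aestronglyMeasurable 1 (ae_of_all _ fun ω => by
        rw [Real.norm_of_nonneg (hg0 ω)]; exact min_le_right _ _)
    have hreal : ∫ ω in B, min (X ω) (n + 1) ∂P ≤ P.real B := by
      simp_rw [hscale n]
      rw [integral_const_mul, ← setIntegral_condExp hm hgi hB]
      calc ((n : ℝ) + 1) * ∫ ω in B, (P[(fun ω => min (X ω / (n + 1)) 1)|m]) ω ∂P
          ≤ (n + 1) * ∫ _ in B, 1 / ((n : ℝ) + 1) ∂P := by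
            exact mul_le_mul_of_nonneg_left (setIntegral_mono_ae integrable_condExp.integrableOn
              (integrable_const _).integrableOn (hle n)) (by positivity)
        _ = P.real B := by
            rw [setIntegral_const, smul_eq_mul]
            field_simp
    rw [← ofReal_integral_eq_lintegral_ofReal]
    · exact (ENNReal.ofReal_le_ofReal hreal).trans (ofReal_measureReal (by finiteness)).le
    · simp_rw [hscale n]
      exact (hgi.const_mul _).integrableOn
    · exact ae_of_all _ fun ω => le_min (hX0 ω) (by positivity)
  refine le_of_tendsto' (lintegral_tendsto_of_tendsto_of_monotone
    (f := fun (n : ℕ) ω => ENNReal.ofReal (min (X ω) (n + 1)))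
    (fun n => (hX.min measurable_const).ennreal_ofReal.aemeasurable) (ae_of_all _ ?_)
    (ae_of_all _ ?_)) htrunc
  · intro ω a b hab
    dsimp only
    gcongr
  · intro ω
    refine tendsto_const_nhds.congr' ?_
    obtain ⟨N, hN⟩ := exists_nat_ge (X ω)
    filter_upwards [eventually_ge_atTop N] with n hn
    have : (N : ℝ) ≤ n := by exact_mod_cast hn
    rw [min_eq_left (by linarith)]

section BayesProcess

variable {ι S E Ω : Type} [Fintype ι] [Fintype S]
    [NormedAddCommGroup E] [NormedSpace ℝ E] [MeasurableSpace E]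
    [mΩ : MeasurableSpace Ω]
    {P : Measure Ω} {F : Filtration ℕ mΩ}
    {strue : S} {Q : Set E} {φ : S → E → (ι → ℝ) → ℝ}
    {θ0 : S → ℝ} {θ : ℕ → Ω → S → ℝ} {q : ℕ → Ω → E} {c : ℕ → Ω → ι → ℝ}

theorem IsBayesEnv.integrable (henv : IsBayesEnv strue Q φ) (s : S) {x : E} (hx : x ∈ Q) :
    Integrable (φ s x) := by
  by_contra h
  have := (henv.2.2.2.2 s x hx).2
  rw [integral_undef h] at this
  exact zero_ne_one this

theorem IsBayesProcess.measurable_pair (hproc : IsBayesProcess P F strue Q φ θ0 θ q c) (t : ℕ) :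
    Measurable fun ω => (q t ω, c t ω) := by
  obtain ⟨-, -, -, -, hq, hc, -, -, -⟩ := hproc
  exact ((hq t).mono (F.le _) le_rfl).prodMk ((hc t).mono (F.le _) le_rfl)

theorem IsBayesProcess.ae_density_pos_s2 [IsProbabilityMeasure P] (henv : IsBayesEnv strue Q φ)
    (hproc : IsBayesProcess P F strue Q φ θ0 θ q c) (t : ℕ) :
    ∀ᵐ ω ∂P, 0 < φ strue (q t ω) (c t ω) := by
  have hpair := hproc.measurable_pair t
  obtain ⟨-, -, hφm, -, hφ⟩ := henv
  obtain ⟨-, -, -, hQ, -, -, -, hcond, -⟩ := hproc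
  set A : Set (E × (ι → ℝ)) := {p | φ strue p.1 p.2 ≤ 0}
  have hA : MeasurableSet A := measurableSet_le (hφm strue) measurable_const
  set g : E × (ι → ℝ) → ℝ := A.indicator fun _ => 1
  have hgm : Measurable g := measurable_const.indicator hA
  have hg0 (p) : 0 ≤ g p := Set.indicator_nonneg (fun _ _ => zero_le_one) p
  have hg1 (p) : g p ≤ 1 := Set.indicator_le_self' (fun _ _ => zero_le_one) p
  have hgabs (p) : |g p| ≤ 1 := by rw [abs_of_nonneg (hg0 p)]; exact hg1 p
  have hzero : P[(fun ω => g (q t ω, c t ω))|F t] =ᵐ[P] 0 := by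
    filter_upwards [hcond t g hgm hgabs] with ω hω
    rw [hω, Pi.zero_apply]
    refine integral_eq_zero_of_ae (ae_of_all _ fun x => ?_)
    by_cases hx : (q t ω, x) ∈ A
    · have : φ strue (q t ω) x = 0 := le_antisymm hx ((hφ strue _ (hQ t ω)).1 x)
      simp [this]
    · simp [g, hx]
  have hint : ∫ ω, g (q t ω, c t ω) ∂P = 0 := by
    rw [← integral_condExp (F.le t), integral_congr_ae hzero]
    simp
  have hgi : Integrable (fun ω => g (q t ω, c t ω)) P :=
    Integrable.of_bound (hgm.comp hpair).aestronglyMeasurable 1 (ae_of_all _ fun ω => hgabs _)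
  rw [integral_eq_zero_iff_of_nonneg (fun ω => hg0 _) hgi] at hint
  filter_upwards [hint] with ω hω
  by_contra h
  have hmem : (q t ω, c t ω) ∈ A := not_lt.1 h
  simp [g, hmem] at hω

theorem IsBayesProcess.setLIntegral_ratio_le [IsProbabilityMeasure P]
    (henv : IsBayesEnv strue Q φ) (hproc : IsBayesProcess P F strue Q φ θ0 θ q c) (t : ℕ) (s : S)
    {B : Set Ω} (hB : MeasurableSet[F t] B) :
    ∫⁻ ω in B, ENNReal.ofReal (φ s (q t ω) (c t ω) / φ strue (q t ω) (c t ω)) ∂P ≤ P B := by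
  have hpair := hproc.measurable_pair t
  have hφi := @henv.integrable
  obtain ⟨-, -, hφm, -, hφ⟩ := henv
  obtain ⟨-, -, -, hQ, -, -, -, hcond, -⟩ := hproc
  have hρ : Measurable fun p : E × (ι → ℝ) => φ s p.1 p.2 / φ strue p.1 p.2 :=
    (hφm s).div (hφm strue)
  have hρ0 {x : E} (hx : x ∈ Q) (y : ι → ℝ) : 0 ≤ φ s x y / φ strue x y :=
    div_nonneg ((hφ s x hx).1 y) ((hφ strue x hx).1 y)
  refine setLIntegral_ofReal_le_of_condExp_min_le (F.le t) (hρ.comp hpair)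
    (fun ω => hρ0 (hQ t ω) _) (fun n => ?_) hB
  set g : E × (ι → ℝ) → ℝ := fun p => max 0 (min (φ s p.1 p.2 / φ strue p.1 p.2 / (n + 1)) 1)
  have hgm : Measurable g := measurable_const.max ((hρ.div_const _).min measurable_const)
  have hgabs (p) : |g p| ≤ 1 := by
    rw [abs_of_nonneg (le_max_left _ _)]
    exact max_le zero_le_one (min_le_right _ _)
  have hgQ {x : E} (hx : x ∈ Q) (y : ι → ℝ) :
      g (x, y) = min (φ s x y / φ strue x y / (n + 1)) 1 :=
    max_eq_right (le_min (div_nonneg (hρ0 hx y) (by positivity)) zero_le_one)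
  have hgeq : (fun ω => min (((fun p : E × (ι → ℝ) => φ s p.1 p.2 / φ strue p.1 p.2) ∘
      fun ω => (q t ω, c t ω)) ω / (n + 1)) 1) = fun ω => g (q t ω, c t ω) :=
    funext fun ω => (hgQ (hQ t ω) _).symm
  rw [hgeq]
  filter_upwards [hcond t g hgm hgabs] with ω hω
  rw [hω]
  calc ∫ y, g (q t ω, y) * φ strue (q t ω) y ≤ ∫ y, φ s (q t ω) y / (n + 1) := by
        refine integral_mono_of_nonneg
          (ae_of_all _ fun y => mul_nonneg (le_max_left _ _) ((hφ strue _ (hQ t ω)).1 y))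
          ((hφi s (hQ t ω)).div_const _) (ae_of_all _ fun y => ?_)
        have hs := (hφ s _ (hQ t ω)).1 y
        dsimp only
        rw [hgQ (hQ t ω)]
        rcases ((hφ strue _ (hQ t ω)).1 y).eq_or_lt with h | h
        · rw [← h, mul_zero]
          positivity
        · calc _ ≤ φ s (q t ω) y / φ strue (q t ω) y / (n + 1) * φ strue (q t ω) y := by
                gcongr
                exact min_le_left _ _
            _ = φ s (q t ω) y / (n + 1) := by field_simp
    _ = 1 / ((n : ℝ) + 1) := by rw [integral_div, (hφ s _ (hQ t ω)).2]

theorem IsBayesProcess.belief_nonneg (henv : IsBayesEnv strue Q φ)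
    (hproc : IsBayesProcess P F strue Q φ θ0 θ q c) (t : ℕ) (ω : Ω) (s : S) : 0 ≤ θ t ω s := by
  obtain ⟨-, -, -, -, hφ⟩ := henv
  obtain ⟨hpos, -, h0, hQ, -, -, -, -, hrec⟩ := hproc
  induction t generalizing s with
  | zero => rw [h0]; exact (hpos s).le
  | succ t ih =>
    rw [hrec]
    exact div_nonneg (mul_nonneg (ih s) ((hφ s _ (hQ t ω)).1 _))
      (Finset.sum_nonneg fun s' _ => mul_nonneg (ih s') ((hφ s' _ (hQ t ω)).1 _))

theorem IsBayesProcess.belief_pos_and_sum_eq_one (henv : IsBayesEnv strue Q φ)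
    (hproc : IsBayesProcess P F strue Q φ θ0 θ q c) {ω : Ω}
    (hω : ∀ t, 0 < φ strue (q t ω) (c t ω)) (t : ℕ) :
    0 < θ t ω strue ∧ ∑ s, θ t ω s = 1 := by
  have hnn := hproc.belief_nonneg henv
  obtain ⟨-, -, -, -, hφ⟩ := henv
  obtain ⟨hpos, hsum, h0, hQ, -, -, -, -, hrec⟩ := hproc
  induction t with
  | zero => rw [h0]; exact ⟨hpos strue, hsum⟩
  | succ t ih =>
    have hden : 0 < ∑ s', θ t ω s' * φ s' (q t ω) (c t ω) :=
      (mul_pos ih.1 (hω t)).trans_le (Finset.single_le_sum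
        (f := fun s' => θ t ω s' * φ s' (q t ω) (c t ω))
        (fun s' _ => mul_nonneg (hnn t ω s') ((hφ s' _ (hQ t ω)).1 _)) (Finset.mem_univ strue))
    refine ⟨?_, ?_⟩
    · rw [hrec]
      exact div_pos (mul_pos ih.1 (hω t)) hden
    · simp_rw [hrec]
      rw [← Finset.sum_div, div_self hden.ne']

/-- The likelihood ratio of any parameter to the true one converges almost surely. -/
theorem IsBayesProcess.ae_tendsto_likelihoodRatio [IsProbabilityMeasure P]
    (henv : IsBayesEnv strue Q φ) (hproc : IsBayesProcess P F strue Q φ θ0 θ q c) (s : S) :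
    ∀ᵐ ω ∂P, ∃ l, Tendsto (fun t => θ t ω s / θ t ω strue) atTop (𝓝 l) := by
  have hnn := hproc.belief_nonneg henv
  have hratio (t : ℕ) (B : Set Ω) (hB : MeasurableSet[F t] B) :=
    hproc.setLIntegral_ratio_le henv t s hB
  have hpair := hproc.measurable_pair
  obtain ⟨-, -, hφm, -, hφ⟩ := henv
  obtain ⟨-, -, h0, hQ, -, -, hθm, -, hrec⟩ := hproc
  have hLm (t : ℕ) : Measurable[F t] fun ω => θ t ω s / θ t ω strue :=
    ((measurable_pi_apply s).comp (hθm t)).div ((measurable_pi_apply strue).comp (hθm t))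
  have hr (t : ℕ) : Measurable fun ω => φ s (q t ω) (c t ω) / φ strue (q t ω) (c t ω) :=
    ((hφm s).div (hφm strue)).comp (hpair t)
  have hL0 (t : ℕ) (ω : Ω) : 0 ≤ θ t ω s / θ t ω strue := div_nonneg (hnn t ω s) (hnn t ω strue)
  have hstep (t : ℕ) (ω : Ω) : θ (t + 1) ω s / θ (t + 1) ω strue ≤
      θ t ω s / θ t ω strue * (φ s (q t ω) (c t ω) / φ strue (q t ω) (c t ω)) := by
    rw [hrec, hrec]
    rcases eq_or_ne (∑ s', θ t ω s' * φ s' (q t ω) (c t ω)) 0 with h | h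
    · rw [h, div_zero, zero_div]
      exact mul_nonneg (hL0 t ω)
        (div_nonneg ((hφ s _ (hQ t ω)).1 _) ((hφ strue _ (hQ t ω)).1 _))
    · rw [div_div_div_cancel_right₀ h, div_mul_div_comm]
  refine ae_tendsto_of_setLIntegral_succ_le hL0 hLm ?_ fun t B hB => ?_
  · simp [h0]
  · have hBm := F.le t B hB
    have hf : Measurable[F t] (B.indicator fun ω => ENNReal.ofReal (θ t ω s / θ t ω strue)) :=
      (hLm t).ennreal_ofReal.indicator hB
    calc ∫⁻ ω in B, ENNReal.ofReal (θ (t + 1) ω s / θ (t + 1) ω strue) ∂P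
        ≤ ∫⁻ ω in B, ENNReal.ofReal (θ t ω s / θ t ω strue) *
            ENNReal.ofReal (φ s (q t ω) (c t ω) / φ strue (q t ω) (c t ω)) ∂P := by
          refine lintegral_mono fun ω => ?_
          rw [← ENNReal.ofReal_mul (hL0 t ω)]
          exact ENNReal.ofReal_le_ofReal (hstep t ω)
      _ = ∫⁻ ω, B.indicator (fun ω => ENNReal.ofReal (θ t ω s / θ t ω strue)) ω *
            ENNReal.ofReal (φ s (q t ω) (c t ω) / φ strue (q t ω) (c t ω)) ∂P := by
          rw [← lintegral_indicator hBm]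
          simp_rw [Set.indicator_mul_left]
      _ ≤ ∫⁻ ω, B.indicator (fun ω => ENNReal.ofReal (θ t ω s / θ t ω strue)) ω ∂P :=
          lintegral_mul_le_of_setLIntegral_le (F.le t) (hr t).ennreal_ofReal
            (hratio t) hf
      _ = ∫⁻ ω in B, ENNReal.ofReal (θ t ω s / θ t ω strue) ∂P := lintegral_indicator hBm _

end BayesProcess

/-- **Almost-sure convergence of Bayesian beliefs.** There is a random belief `θ̄ ∈ Δ(S)`
such that `θ^t(s) → θ̄(s)` a.s. for every `s`, and `θ̄(s*) > 0` a.s. -/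
theorem belief_convergence {ι S E Ω : Type} [Fintype ι] [Fintype S]
    [NormedAddCommGroup E] [NormedSpace ℝ E] [MeasurableSpace E] [BorelSpace E]
    [mΩ : MeasurableSpace Ω]
    (P : Measure Ω) [IsProbabilityMeasure P] (F : Filtration ℕ mΩ)
    (strue : S) (Q : Set E) (φ : S → E → (ι → ℝ) → ℝ)
    (θ0 : S → ℝ) (θ : ℕ → Ω → S → ℝ) (q : ℕ → Ω → E) (c : ℕ → Ω → ι → ℝ)
    (henv : IsBayesEnv strue Q φ)
    (hproc : IsBayesProcess P F strue Q φ θ0 θ q c) :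
    ∃ θbar : Ω → S → ℝ, ∀ᵐ ω ∂P,
      (∀ s, 0 ≤ θbar ω s) ∧ (∑ s, θbar ω s = 1) ∧
      (∀ s, Tendsto (fun t => θ t ω s) atTop (𝓝 (θbar ω s))) ∧
      0 < θbar ω strue := by
  have hconv : ∀ᵐ ω ∂P, ∀ s, ∃ l, Tendsto (fun t => θ t ω s / θ t ω strue) atTop (𝓝 l) :=
    ae_all_iff.2 (hproc.ae_tendsto_likelihoodRatio henv)
  have hpos : ∀ᵐ ω ∂P, ∀ t, 0 < φ strue (q t ω) (c t ω) :=
    ae_all_iff.2 (hproc.ae_density_pos_s2 henv)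
  have hex : ∀ᵐ ω ∂P, ∃ b : S → ℝ, (∀ s, 0 ≤ b s) ∧ (∑ s, b s = 1) ∧
      (∀ s, Tendsto (fun t => θ t ω s) atTop (𝓝 (b s))) ∧ 0 < b strue := by
    filter_upwards [hconv, hpos] with ω hω hφω
    choose L hL using hω
    have hbelief := hproc.belief_pos_and_sum_eq_one henv hφω
    have hL0 (s : S) : 0 ≤ L s := ge_of_tendsto' (hL s) fun t =>
      div_nonneg (hproc.belief_nonneg henv t ω s) (hbelief t).1.le
    have hLtrue : L strue = 1 := by
      refine tendsto_nhds_unique (hL strue) (tendsto_const_nhds.congr fun t => ?_)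
      rw [div_self (hbelief t).1.ne']
    have hsum : 0 < ∑ s, L s := (hLtrue ▸ zero_lt_one : 0 < L strue).trans_le
      (Finset.single_le_sum (fun s _ => hL0 s) (Finset.mem_univ strue))
    refine ⟨fun s => L s / ∑ s', L s', fun s => div_nonneg (hL0 s) hsum.le, ?_, fun s => ?_, ?_⟩
    · rw [← Finset.sum_div, div_self hsum.ne']
    · refine ((hL s).div (tendsto_finsetSum _ fun s' _ => hL s') hsum.ne').congr fun t => ?_
      simp only [Pi.div_apply]
      rw [← Finset.sum_div, (hbelief t).2, div_div_div_cancel_right₀ (hbelief t).1.ne', div_one]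
    · exact div_pos (hLtrue ▸ zero_lt_one) hsum
  exact hex.choice
end
end

section
/- Consider the Bayesian learning dynamics with an adapted strategy sequence (q^t). Fix s ∈ S and q̄ ∈ Q, and suppose there exist ε > 0 and an open neighborhood V of q̄ in Q such that ∫ 1{φ^s(c|q) = 0} φ^{s*}(c|q) dc > ε for all q ∈ V. Then almost surely on the event {q^t → q̄}, there is a finite random time T such that θ^t(s) = 0 for all t > T. -/
open MeasureTheory ProbabilityTheory Filter Topology

noncomputable section

/-- A nonnegative real sequence that is eventually above a positive constant has divergent
partial sums. -/
lemma tendsto_sum_range_atTop_of_eventually_lt {f : ℕ → ℝ} {ε : ℝ} (hε : 0 < ε)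
    (hf : ∀ n, 0 ≤ f n) (h : ∀ᶠ n in atTop, ε < f n) :
    Tendsto (fun n => ∑ k ∈ Finset.range n, f k) atTop atTop := by
  rw [← not_summable_iff_tendsto_nat_atTop_of_nonneg hf]
  intro hs
  obtain ⟨n, h1, h2⟩ := (h.and (hs.tendsto_atTop_zero.eventually_lt_const hε)).exists
  exact lt_asymm h1 h2

/-- **Beliefs of non-absolutely-continuous parameters vanish in finite time.**
If on an open neighborhood `V` of `q̄` (relative to `Q`) the true density puts mass more
than `ε > 0` on the zero set of `φ^s(·∣q)`, then almost surely, on the event that the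
strategies converge to `q̄`, there is a finite time `T` with `θ^t(s) = 0` for all
`t > T`. -/
theorem belief_zero_finite_time {ι S E Ω : Type} [Fintype ι] [Fintype S]
    [NormedAddCommGroup E] [NormedSpace ℝ E] [MeasurableSpace E] [BorelSpace E]
    [mΩ : MeasurableSpace Ω]
    (P : Measure Ω) [IsProbabilityMeasure P] (F : Filtration ℕ mΩ)
    (strue : S) (Q : Set E) (φ : S → E → (ι → ℝ) → ℝ)
    (θ0 : S → ℝ) (θ : ℕ → Ω → S → ℝ) (q : ℕ → Ω → E) (c : ℕ → Ω → ι → ℝ)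
    (henv : IsBayesEnv strue Q φ)
    (hproc : IsBayesProcess P F strue Q φ θ0 θ q c)
    (s : S) (qbar : E) (hqbar : qbar ∈ Q)
    (ε : ℝ) (hε : 0 < ε) (V : Set E) (hV : IsOpen V) (hmemV : qbar ∈ V)
    (hsep : ∀ q' ∈ V ∩ Q,
      ε < ∫ x : ι → ℝ, Set.indicator {x | φ s q' x = 0} (φ strue q') x) :
    ∀ᵐ ω ∂P, Tendsto (fun t => q t ω) atTop (𝓝 qbar) →
      ∃ T : ℕ, ∀ t > T, θ t ω s = 0 := by
  obtain ⟨-, -, hmeas, -, hdens⟩ := henv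
  obtain ⟨-, -, -, hqQ, hq, hc, -, hcond, hbayes⟩ := hproc
  set Z : Set (E × (ι → ℝ)) := {p | φ s p.1 p.2 = 0} with hZdef
  have hZ : MeasurableSet Z := hmeas s (measurableSet_singleton 0)
  set g : E × (ι → ℝ) → ℝ := Z.indicator 1 with hg
  let A : ℕ → Set Ω := fun n => {ω | 0 < n ∧ (q (n - 1) ω, c (n - 1) ω) ∈ Z}
  have hA : ∀ n, MeasurableSet[F n] (A n) := by
    rintro (_ | n)
    · simp [A]
    · have hpair : Measurable[F (n + 1)] fun ω => (q n ω, c n ω) :=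
        ((hq n).mono (F.mono n.le_succ) le_rfl).prodMk (hc n)
      have hset : A (n + 1) = (fun ω => (q n ω, c n ω)) ⁻¹' Z := by
        ext ω
        simp [A]
      rw [hset]
      exact hpair hZ
  have hAg : ∀ n, (A (n + 1)).indicator (1 : Ω → ℝ) = fun ω => g (q n ω, c n ω) := by
    intro n
    ext ω
    simp [A, hg, Set.indicator_apply]
  have hgbound : ∀ p, |g p| ≤ 1 := by
    intro p
    by_cases hp : p ∈ Z <;> simp [hg, hp]
  have hcondA : ∀ᵐ ω ∂P, ∀ n, (P[(A (n + 1)).indicator (1 : Ω → ℝ)|F n]) ω =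
      ∫ x : ι → ℝ, Set.indicator {x | φ s (q n ω) x = 0} (φ strue (q n ω)) x := by
    refine ae_all_iff.2 fun n => ?_
    rw [hAg n]
    filter_upwards [hcond n g (measurable_one.indicator hZ) hgbound] with ω hω
    rw [hω]
    congr 1 with x
    simp [hg, hZdef, Set.indicator_apply]
  filter_upwards [ae_mem_limsup_atTop_iff P hA, hcondA] with ω hlim hω hconv
  have hdiv : Tendsto (fun n => ∑ k ∈ Finset.range n,
      (P[(A (k + 1)).indicator (1 : Ω → ℝ)|F k]) ω) atTop atTop := by
    refine tendsto_sum_range_atTop_of_eventually_lt hε (fun n => ?_) ?_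
    · rw [hω n]
      exact integral_nonneg fun x =>
        Set.indicator_nonneg (fun y _ => (hdens strue _ (hqQ n ω)).1 y) x
    · filter_upwards [hconv (hV.mem_nhds hmemV)] with n hn
      rw [hω n]
      exact hsep _ ⟨hn, hqQ n ω⟩
  obtain ⟨n, hn, hzero⟩ := (mem_limsup_iff_frequently_mem.1 (hlim.2 hdiv)).exists
  have hsucc : θ n ω s = 0 := by
    obtain ⟨m, rfl⟩ := Nat.exists_eq_succ_of_ne_zero hn.ne'
    have hm : φ s (q m ω) (c m ω) = 0 := hzero
    simp [hbayes m ω s, hm]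
  refine ⟨n, fun t ht => ?_⟩
  induction t, ht.le using Nat.le_induction with
  | base => exact hsucc
  | succ t hnt ih =>
    have hθ : θ t ω s = 0 := by
      rcases hnt.eq_or_lt with rfl | h
      · exact hsucc
      · exact ih h
    simp [hbayes t ω s, hθ]
end
end

section
/- Let Θ be a metric space, Y a compact metric space, and Z a compact subset of a Euclidean space. Let B : Θ × Y ⇒ Z be a correspondence with nonempty compact values that is continuous, i.e., both upper hemicontinuous (for every (θ, y) and every open U ⊇ B(θ, y), B(θ', y') ⊆ U for all (θ', y') in some neighborhood of (θ, y)) and lower hemicontinuous (for every (θ, y), every z ∈ B(θ, y) and every neighborhood W of z, B(θ', y') ∩ W ≠ ∅ for all (θ', y') in some neighborhood of (θ, y)). If θ^t → θ̄ in Θ, (y^t) is any sequence in Y, and h^t ∈ B(θ^t, y^t) for every t, then dist(h^t, B(θ̄, y^t)) → 0. -/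
open Filter Topology Metric

/-- A lower hemicontinuous correspondence with a compact value at `x₀` comes uniformly close to
every point of that value at nearby points. -/
theorem eventually_forall_infDist_lt_of_lowerHemicontinuous {X E : Type*} [TopologicalSpace X]
    [PseudoMetricSpace E] {F : X → Set E} {x₀ : X} (hcomp : IsCompact (F x₀))
    (hlhc : ∀ z ∈ F x₀, ∀ W : Set E, IsOpen W → z ∈ W → ∀ᶠ x in 𝓝 x₀, (F x ∩ W).Nonempty)
    {ε : ℝ} (hε : 0 < ε) :
    ∀ᶠ x in 𝓝 x₀, ∀ z ∈ F x₀, infDist z (F x) < ε := by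
  refine hcomp.eventually_forall_of_forall_eventually fun z hz ↦ ?_
  have hx := hlhc z hz (ball z (ε / 2)) isOpen_ball (mem_ball_self (half_pos hε))
  have hw := ball_mem_nhds z (half_pos hε)
  rw [nhds_prod_eq]
  filter_upwards [hx.prod_mk hw] with ⟨x, w⟩ ⟨⟨v, hv, hvz⟩, hwz⟩
  calc infDist w (F x) ≤ dist w v := infDist_le_dist_of_mem hv
    _ ≤ dist w z + dist v z := dist_triangle_right _ _ _
    _ < ε / 2 + ε / 2 := add_lt_add hwz hvz
    _ = ε := add_halves ε

/-- **Residual-vanishing lemma for continuous correspondences.**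
Let `B : Θ × Y ⇒ Z` be a correspondence with nonempty compact values contained in a
compact set `Z` of a Euclidean space, upper and lower hemicontinuous.  If `θ t → θ̄`,
`(y t)` is any sequence, and `h t ∈ B (θ t) (y t)`, then
`dist (h t) (B θ̄ (y t)) → 0`. -/
theorem residual_vanishing {Θ Y : Type*} [MetricSpace Θ] [MetricSpace Y] [CompactSpace Y]
    {n : ℕ} (Z : Set (EuclideanSpace ℝ (Fin n))) (hZ : IsCompact Z)
    (B : Θ → Y → Set (EuclideanSpace ℝ (Fin n)))
    (hBZ : ∀ θ y, B θ y ⊆ Z)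
    (hne : ∀ θ y, (B θ y).Nonempty)
    (hcomp : ∀ θ y, IsCompact (B θ y))
    (huhc : ∀ (θ : Θ) (y : Y) (U : Set (EuclideanSpace ℝ (Fin n))),
      IsOpen U → B θ y ⊆ U → ∀ᶠ p : Θ × Y in 𝓝 (θ, y), B p.1 p.2 ⊆ U)
    (hlhc : ∀ (θ : Θ) (y : Y), ∀ z ∈ B θ y, ∀ W : Set (EuclideanSpace ℝ (Fin n)),
      IsOpen W → z ∈ W → ∀ᶠ p : Θ × Y in 𝓝 (θ, y), (B p.1 p.2 ∩ W).Nonempty)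
    (θseq : ℕ → Θ) (θbar : Θ) (hθ : Tendsto θseq atTop (𝓝 θbar))
    (yseq : ℕ → Y) (hseq : ℕ → EuclideanSpace ℝ (Fin n))
    (hmem : ∀ t, hseq t ∈ B (θseq t) (yseq t)) :
    Tendsto (fun t => infDist (hseq t) (B θbar (yseq t))) atTop (𝓝 0) := by
  have key : ∀ ε > 0, ∀ᶠ θ in 𝓝 θbar, ∀ y ∈ (Set.univ : Set Y),
      ∀ z ∈ B θ y, infDist z (B θbar y) < ε := by
    intro ε hε
    refine isCompact_univ.eventually_forall_of_forall_eventually fun y _ ↦ ?_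
    have hupper := huhc θbar y _ isOpen_thickening (self_subset_thickening (half_pos hε) _)
    have hlower : ∀ᶠ p : Θ × Y in 𝓝 (θbar, y),
        ∀ z ∈ B θbar y, infDist z (B p.1 p.2) < ε / 2 :=
      eventually_forall_infDist_lt_of_lowerHemicontinuous (F := fun p : Θ × Y ↦ B p.1 p.2)
        (hcomp θbar y) (hlhc θbar y) (half_pos hε)
    have hslice : Tendsto (fun p : Θ × Y ↦ (θbar, p.2)) (𝓝 (θbar, y)) (𝓝 (θbar, y)) :=
      Continuous.tendsto (by fun_prop) (θbar, y)
    filter_upwards [hupper, hslice.eventually hlower] with p hp hq z hz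
    obtain ⟨w, hw, hzw⟩ := mem_thickening_iff.mp (hp hz)
    calc infDist z (B θbar p.2) ≤ infDist w (B θbar p.2) + dist z w :=
          infDist_le_infDist_add_dist
      _ < ε / 2 + ε / 2 := add_lt_add (hq w hw) hzw
      _ = ε := add_halves ε
  refine tendsto_order.2 ⟨fun a ha ↦ Eventually.of_forall fun t ↦ ha.trans_le infDist_nonneg,
    fun ε hε ↦ ?_⟩
  filter_upwards [hθ.eventually (key ε hε)] with t ht
  exact ht (yseq t) (Set.mem_univ _) (hseq t) (hmem t)
end

section
/- Let Q = ∏_{i∈I} Q_i with each Q_i a convex subset of a Euclidean space, and let F : Q → ℝ be differentiable and such that F(·, q_{-i}) is concave on Q_i for every i and every q_{-i}. Fix q ∈ Q, for each i pick h_i ∈ argmax_{y∈Q_i} F(y, q_{-i}), and pick weights α_i ∈ (0, 1]. Then Σ_{i∈I} α_i ∇_{q_i} F(q)·(h_i − q_i) ≥ Σ_{i∈I} α_i ( F(h_i, q_{-i}) − F(q) ) ≥ 0, and the middle sum Σ_{i∈I} α_i ( F(h_i, q_{-i}) − F(q) ) is strictly positive unless q_i ∈ argmax_{y∈Q_i}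 F(y, q_{-i}) for every i, i.e., unless q is an equilibrium of the game with potential F. In particular, the potential is nondecreasing along the asynchronous best-response dynamics and strictly increasing outside the equilibrium set. -/
open Function

/-- A function that is concave in the `i`-th block and differentiable within a product of sets lies,
along that block, below its linearization. -/
theorem update_sub_le_fderivWithin_single {ι : Type*} [Fintype ι] [DecidableEq ι]
    {E : ι → Type*} [∀ i, NormedAddCommGroup (E i)] [∀ i, NormedSpace ℝ (E i)]
    {S : ∀ i, Set (E i)} {F : (∀ i, E i) → ℝ} {q : ∀ i, E i} {i : ι} {y : E i}
    (hF : DifferentiableWithinAt ℝ F (Set.univ.pi S) q)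
    (hconc : ConcaveOn ℝ (S i) fun z => F (update q i z))
    (hq : q ∈ Set.univ.pi S) (hy : y ∈ S i) :
    F (update q i y) - F q ≤ fderivWithin ℝ F (Set.univ.pi S) q (Pi.single i (y - q i)) := by
  have hqi : q i ∈ S i := hq i (Set.mem_univ i)
  have hline : ∀ t : ℝ, update q i (AffineMap.lineMap (q i) y t) =
      q + t • Pi.single i (y - q i) := by
    intro t
    ext j
    obtain rfl | hj := eq_or_ne j i
    · simp [AffineMap.lineMap_apply, add_comm]
    · simp [hj]
  have hmem : ∀ t ∈ Set.Icc (0 : ℝ) 1, AffineMap.lineMap (q i) y t ∈ S i :=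
    fun t ht => hconc.1.lineMap_mem hqi hy ht
  have hg : ConcaveOn ℝ (Set.Icc (0 : ℝ) 1)
      fun t => F (q + t • Pi.single i (y - q i)) := by
    have := (hconc.comp_affineMap (AffineMap.lineMap (q i) y)).subset hmem (convex_Icc 0 1)
    simpa only [comp_def, hline] using this
  have hmaps : Set.MapsTo (fun t : ℝ => q + t • Pi.single i (y - q i)) (Set.Icc 0 1)
      (Set.univ.pi S) := by
    intro t ht
    simp only [← hline]
    exact (Set.update_mem_pi_iff_of_mem hq).2 fun _ => hmem t ht
  have hd : HasDerivWithinAt (fun t : ℝ => q + t • Pi.single i (y - q i))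
      (Pi.single i (y - q i)) (Set.Icc 0 1) 0 := by
    simpa using (((hasDerivAt_id (0 : ℝ)).smul_const
      (Pi.single i (y - q i))).const_add q).hasDerivWithinAt (s := Set.Icc 0 1)
  have hF' : HasFDerivWithinAt F (fderivWithin ℝ F (Set.univ.pi S) q) (Set.univ.pi S)
      (q + (0 : ℝ) • Pi.single i (y - q i)) := by
    simpa using hF.hasFDerivWithinAt
  have hslope := hg.slope_le_of_hasDerivWithinAt (by simp) (by simp) one_pos
    (hF'.comp_hasDerivWithinAt 0 hd hmaps)
  have h1 := hline 1
  simp only [AffineMap.lineMap_apply_one] at h1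
  simpa [slope_def_field, h1] using hslope

/-- **The potential increases along asynchronous best-response directions.**
For a differentiable potential `F` that is concave in each player's block of
coordinates, best responses `h i` and weights `α i ∈ (0,1]` satisfy
`Σ α i ∇_{q i} F(q)·(h i − q i) ≥ Σ α i (F(h i, q₋ᵢ) − F(q)) ≥ 0`, with the middle
sum strictly positive unless `q` is an equilibrium of the potential game. -/
theorem potential_increase {ι : Type*} [Fintype ι] [DecidableEq ι]
    {E : ι → Type*} [∀ i, NormedAddCommGroup (E i)] [∀ i, NormedSpace ℝ (E i)]
    (Qi : ∀ i, Set (E i)) (hQconv : ∀ i, Convex ℝ (Qi i))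
    (F : (∀ i, E i) → ℝ)
    (hdiff : DifferentiableOn ℝ F (Set.univ.pi Qi))
    (hconc : ∀ (i : ι), ∀ p ∈ Set.univ.pi Qi,
      ConcaveOn ℝ (Qi i) fun y => F (Function.update p i y))
    (q : ∀ i, E i) (hq : q ∈ Set.univ.pi Qi)
    (h : ∀ i, E i)
    (hh : ∀ i, h i ∈ Qi i ∧
      ∀ y ∈ Qi i, F (Function.update q i y) ≤ F (Function.update q i (h i)))
    (α : ι → ℝ) (hα : ∀ i, α i ∈ Set.Ioc (0 : ℝ) 1) :
    (∑ i, α i * (F (Function.update q i (h i)) - F q) ≤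
        ∑ i, α i * fderivWithin ℝ F (Set.univ.pi Qi) q (Pi.single i (h i - q i))) ∧
    (0 ≤ ∑ i, α i * (F (Function.update q i (h i)) - F q)) ∧
    ((¬ ∀ i, ∀ y ∈ Qi i, F (Function.update q i y) ≤ F q) →
      0 < ∑ i, α i * (F (Function.update q i (h i)) - F q)) := by
  have hnonneg : ∀ i, 0 ≤ α i * (F (update q i (h i)) - F q) := fun i =>
    mul_nonneg (hα i).1.le <| sub_nonneg.2 <| by
      simpa using (hh i).2 (q i) (hq i (Set.mem_univ i))
  refine ⟨Finset.sum_le_sum fun i _ => mul_le_mul_of_nonneg_left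
    (update_sub_le_fderivWithin_single (hdiff q hq) (hconc i q hq) hq (hh i).1) (hα i).1.le,
    Finset.sum_nonneg fun i _ => hnonneg i, fun hne => ?_⟩
  push Not at hne
  obtain ⟨i, y, hy, hlt⟩ := hne
  exact Finset.sum_pos' (fun i _ => hnonneg i) ⟨i, Finset.mem_univ i,
    mul_pos (hα i).1 (sub_pos.2 (hlt.trans_le ((hh i).2 y hy)))⟩
end

section
/- Let ν ∈ (0,1], let L ≤ U be real numbers, and let x : [1, ∞) → ℝ be differentiable with x'(τ) = α(τ)·(h(τ) − x(τ)) for all τ ≥ 1, where α(τ) ∈ [ν, 1] and h(τ) ∈ [L, U] for every τ. Then dist(x(τ), [L, U]) ≤ dist(x(1), [L, U])·e^{−ν(τ−1)} for all τ ≥ 1; in particular dist(x(τ), [L, U]) → 0 as τ → ∞. -/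
open Filter Topology Metric

/-- A function with `y' ≤ -ν y` wherever `y > 0` is bounded by `c * exp (-ν (t - a))` for every
nonnegative `c` that bounds its initial value. -/
lemma le_mul_exp_of_deriv_le_of_pos {ν a c : ℝ} {y y' : ℝ → ℝ} (hν : 0 < ν) (hc : 0 ≤ c)
    (hya : y a ≤ c) (hy : ∀ t ∈ Set.Ici a, HasDerivWithinAt y (y' t) (Set.Ici a) t)
    (hy' : ∀ t ∈ Set.Ici a, 0 < y t → y' t ≤ -ν * y t) {t : ℝ} (ht : t ∈ Set.Ici a) :
    y t ≤ c * Real.exp (-ν * (t - a)) := by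
  refine le_of_forall_pos_le_add fun ε hε => ?_
  have hB : ∀ s, HasDerivAt (fun s => c * Real.exp (-ν * (s - a)) + ε)
      (c * (Real.exp (-ν * (s - a)) * (-ν * 1))) s := fun s =>
    (((((hasDerivAt_id s).sub_const a).const_mul (-ν)).exp).const_mul c).add_const ε
  refine image_le_of_deriv_right_lt_deriv_boundary (f := y) (f' := y') (a := a) (b := t)
    (fun s hs => (hy s hs.1).continuousWithinAt.mono Set.Icc_subset_Ici_self)
    (fun s hs => (hy s hs.1).mono (Set.Ici_subset_Ici.2 hs.1)) ?_ hB ?_ ⟨ht, le_rfl⟩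
  · simp only [sub_self, mul_zero, Real.exp_zero, mul_one]
    linarith
  · intro s hs hys
    have hexp : 0 ≤ c * Real.exp (-ν * (s - a)) := by positivity
    have h := hy' s hs.1 (by rw [hys]; positivity)
    rw [hys] at h
    nlinarith [mul_pos hν hε]

/-- The distance from a real number to an interval. -/
lemma infDist_Icc_eq_max {L U : ℝ} (hLU : L ≤ U) (x : ℝ) :
    infDist x (Set.Icc L U) = max (max (L - x) (x - U)) 0 := by
  apply le_antisymm
  · have hmem : max L (min x U) ∈ Set.Icc L U :=
      ⟨le_max_left _ _, max_le hLU (min_le_right _ _)⟩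
    refine (infDist_le_dist_of_mem hmem).trans ?_
    rw [Real.dist_eq]
    grind
  · refine (le_infDist (Set.nonempty_Icc.2 hLU)).2 fun y hy => ?_
    rw [Real.dist_eq]
    exact max_le (max_le (by linarith [hy.1, neg_abs_le (x - y)])
      (by linarith [hy.2, le_abs_self (x - y)])) (abs_nonneg _)

/-- **Lyapunov decay toward an interval of best responses.**
If `x` solves `x' = α·(h − x)` on `[1,∞)` with `α(τ) ∈ [ν,1]` and `h(τ) ∈ [L,U]`,
then the distance from `x(τ)` to `[L,U]` decays at exponential rate `ν`, and in
particular tends to `0`. -/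
theorem br_interval_decay (ν : ℝ) (hν : ν ∈ Set.Ioc (0 : ℝ) 1)
    (L U : ℝ) (hLU : L ≤ U) (x α h : ℝ → ℝ)
    (hx : ∀ τ ∈ Set.Ici (1 : ℝ),
      HasDerivWithinAt x (α τ * (h τ - x τ)) (Set.Ici (1 : ℝ)) τ)
    (hα : ∀ τ ∈ Set.Ici (1 : ℝ), α τ ∈ Set.Icc ν 1)
    (hh : ∀ τ ∈ Set.Ici (1 : ℝ), h τ ∈ Set.Icc L U) :
    (∀ τ ∈ Set.Ici (1 : ℝ),
        infDist (x τ) (Set.Icc L U) ≤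
          infDist (x 1) (Set.Icc L U) * Real.exp (-ν * (τ - 1))) ∧
    Tendsto (fun τ => infDist (x τ) (Set.Icc L U)) atTop (𝓝 0) := by
  have decay : ∀ τ ∈ Set.Ici (1 : ℝ), infDist (x τ) (Set.Icc L U) ≤
      infDist (x 1) (Set.Icc L U) * Real.exp (-ν * (τ - 1)) := by
    intro τ hτ
    have hc : 0 ≤ infDist (x 1) (Set.Icc L U) := infDist_nonneg
    have h1 := infDist_Icc_eq_max hLU (x 1)
    rw [infDist_Icc_eq_max hLU (x τ)]
    refine max_le (max_le ?_ ?_) (by positivity)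
    · refine le_mul_exp_of_deriv_le_of_pos (y := fun t => L - x t) hν.1 hc (by grind)
        (fun t ht => (hx t ht).const_sub L) (fun t ht hpos => ?_) hτ
      have hαν := (hα t ht).1
      have hL := (hh t ht).1
      nlinarith [mul_nonneg (sub_nonneg.2 hαν) hpos.le,
        mul_nonneg (hν.1.le.trans hαν) (sub_nonneg.2 hL)]
    · refine le_mul_exp_of_deriv_le_of_pos (y := fun t => x t - U) hν.1 hc (by grind)
        (fun t ht => (hx t ht).sub_const U) (fun t ht hpos => ?_) hτ
      have hαν := (hα t ht).1
      have hU := (hh t ht).2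
      nlinarith [mul_nonneg (sub_nonneg.2 hαν) hpos.le,
        mul_nonneg (hν.1.le.trans hαν) (sub_nonneg.2 hU)]
  refine ⟨decay, squeeze_zero' (Eventually.of_forall fun _ => infDist_nonneg)
    ((eventually_ge_atTop 1).mono decay) ?_⟩
  have hexp : Tendsto (fun τ : ℝ => Real.exp (-ν * (τ - 1))) atTop (𝓝 0) :=
    Real.tendsto_exp_atBot.comp
      ((tendsto_atTop_add_const_right _ (-1) tendsto_id).const_mul_atTop_of_neg
        (neg_lt_zero.2 hν.1))
  simpa using hexp.const_mul (infDist (x 1) (Set.Icc L U))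
end

section
/- Let S be a finite set with true parameter s*, Q = ∏_{i∈I} Q_i with each Q_i a convex compact subset of a Euclidean space, and continuous payoff functions u_i^s : Q → ℝ. Let θ̄ ∈ Δ(S) with θ̄(s*) > 0 and let EQ(θ̄) = {q ∈ Q : for every i, q_i maximizes y ↦ Σ_s θ̄(s) u_i^s(y, q_{-i}) over Q_i}. Assume: (i) u_i^s(·, q_{-i}) is concave on Q_i for every i, every q_{-i}, and every s ∈ [θ̄]; and (ii) there exists δ > 0 such that for every q with dist(q, EQ(θ̄)) < δ and every i, Σ_s θ̄(s) u_i^s(q) = u_i^{s*}(q). Then every q̄ ∈ EQ(θ̄) is a Nash equilibrium of the complete-information game with payoffs (u_i^{s*})_{i∈I}: for every i, q̄_i maximizes y ↦ u_i^{s*}(y, q̄_{-i}) over Q_i. -/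
open Function Metric

/-- The probability simplex on a finite set `S`. -/
def simplex (S : Type*) [Fintype S] : Set (S → ℝ) :=
  {θ | (∀ s, 0 ≤ θ s) ∧ ∑ s, θ s = 1}

/-- The set of (Bayesian) Nash equilibria of the game with strategy sets `Qi`,
payoffs `u`, and belief `θ` over the parameter set. -/
def EQset {ι S : Type*} [Fintype ι] [DecidableEq ι] [Fintype S] {E : ι → Type*}
    (Qi : ∀ i, Set (E i)) (u : S → ι → (∀ i, E i) → ℝ) (θ : S → ℝ) :
    Set (∀ i, E i) :=
  {p | p ∈ Set.univ.pi Qi ∧ ∀ i, ∀ y ∈ Qi i,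
    ∑ s, θ s * u s i (Function.update p i y) ≤ ∑ s, θ s * u s i p}

/-- **Fixed points with locally consistent beliefs are complete-information equilibria.**
If payoffs are concave in own strategies for every parameter in the support of `θ̄`,
and the expected payoff under `θ̄` coincides with the true payoff on a `δ`-neighborhood
of `EQ(θ̄)`, then every `q̄ ∈ EQ(θ̄)` is a Nash equilibrium of the complete-information
game with payoffs `u_i^{s*}`. -/
theorem fixed_point_complete_info {ι S : Type*} [Fintype ι] [DecidableEq ι] [Fintype S]
    {E : ι → Type*} [∀ i, NormedAddCommGroup (E i)] [∀ i, NormedSpace ℝ (E i)]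
    (strue : S) (Qi : ∀ i, Set (E i))
    (hQcomp : ∀ i, IsCompact (Qi i)) (hQconv : ∀ i, Convex ℝ (Qi i))
    (u : S → ι → (∀ i, E i) → ℝ)
    (hucont : ∀ s i, ContinuousOn (u s i) (Set.univ.pi Qi))
    (θbar : S → ℝ) (hθbar : θbar ∈ simplex S) (hpos : 0 < θbar strue)
    (hconc : ∀ s, 0 < θbar s → ∀ (i : ι), ∀ p ∈ Set.univ.pi Qi,
      ConcaveOn ℝ (Qi i) fun y => u s i (Function.update p i y))
    (δ : ℝ) (hδ : 0 < δ)
    (heq : ∀ p : ∀ i, E i, infDist p (EQset Qi u θbar) < δ →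
      ∀ i, ∑ s, θbar s * u s i p = u strue i p) :
    ∀ p ∈ EQset Qi u θbar, ∀ (i : ι), ∀ y ∈ Qi i,
      u strue i (Function.update p i y) ≤ u strue i p := by
  intro p hp i y hy
  have hp_mem : p i ∈ Qi i := hp.1 i (Set.mem_univ i)
  have hlocal : IsLocalMaxOn (fun z => u strue i (Function.update p i z)) (Qi i) (p i) := by
    have hupdate : Continuous fun z : E i => Function.update p i z :=
      continuous_const.update i continuous_id
    have hnear : ∀ᶠ z in nhds (p i), infDist (Function.update p i z) (EQset Qi u θbar) < δ := by
      refine ((continuous_infDist_pt _).comp hupdate).continuousAt.eventually_lt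
        continuousAt_const ?_
      simpa [infDist_zero_of_mem hp] using hδ
    filter_upwards [nhdsWithin_le_nhds hnear, self_mem_nhdsWithin] with z hz hzQ
    have hle := hp.2 i z hzQ
    rw [heq _ hz i, heq p (by rwa [infDist_zero_of_mem hp]) i] at hle
    simpa using hle
  have hmax := IsMaxOn.of_isLocalMaxOn_of_concaveOn hp_mem hlocal
    (hconc strue hpos i p hp.1)
  simpa using hmax hy
end
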